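/- (Composition–Diamond lemma, (i) ⇒ (ii).) Let X be a well-ordered set, D(X) the free dialgebra over a field k with the deg-lex order, and S ⊆ D(X) a monic set that is a Gröbner–Shirshov basis in D(X) (all compositions of left multiplication, right multiplication, inclusion and intersection among elements of S are trivial). Then for every nonzero f in the two-sided dialgebra ideal Id(S) generated by S, the leading term of f satisfies [f̄] = [a[s̄]b] for some s ∈ S and words a, b such that [asb] is a normal s-diword. -/

import Mathlib

universe u v

/-- A dialgebra over a field `k`: a `k`-vector space with two bilinear associative
products `lp` (written `⊢` in the paper) and `rp` (written `⊣`) satisfying the three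
dialgebra axioms. -/
class Dialgebra (k : Type*) (D : Type*) [Field k] [AddCommGroup D] [Module k D] where
  lp : D → D → D
  rp : D → D → D
  lp_add_left : ∀ a b c : D, lp (a + b) c = lp a c + lp b c
  lp_add_right : ∀ a b c : D, lp a (b + c) = lp a b + lp a c
  lp_smul_left : ∀ (r : k) (a b : D), lp (r • a) b = r • lp a b
  lp_smul_right : ∀ (r : k) (a b : D), lp a (r • b) = r • lp a b
  rp_add_left : ∀ a b c : D, rp (a + b) c = rp a c + rp b c
  rp_add_right : ∀ a b c : D, rp a (b + c) = rp a b + rp a c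
  rp_smul_left : ∀ (r : k) (a b : D), rp (r • a) b = r • rp a b
  rp_smul_right : ∀ (r : k) (a b : D), rp a (r • b) = r • rp a b
  lp_assoc : ∀ a b c : D, lp (lp a b) c = lp a (lp b c)
  rp_assoc : ∀ a b c : D, rp (rp a b) c = rp a (rp b c)
  di1 : ∀ a b c : D, rp a (lp b c) = rp (rp a b) c
  di2 : ∀ a b c : D, lp (rp a b) c = lp a (lp b c)
  di3 : ∀ a b c : D, lp a (rp b c) = rp (lp a b) c

/-- A Leibniz algebra over a field `k`: a `k`-vector space with a bilinear bracket
satisfying the Leibniz identity `[[a,b],c] = [[a,c],b] + [a,[b,c]]`. -/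
class LeibnizAlgebra (k : Type*) (L : Type*) [Field k] [AddCommGroup L] [Module k L] where
  br : L → L → L
  br_add_left : ∀ a b c : L, br (a + b) c = br a c + br b c
  br_add_right : ∀ a b c : L, br a (b + c) = br a b + br a c
  br_smul_left : ∀ (r : k) (a b : L), br (r • a) b = r • br a b
  br_smul_right : ∀ (r : k) (a b : L), br a (r • b) = r • br a b
  leibniz : ∀ a b c : L, br (br a b) c = br (br a c) b + br a (br b c)

/-- A normal diword over `X`: a nonempty word in `X` together with a marked letter
(its center), recorded as the letters to the left of the center, the center, and the
letters to the right of the center. -/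
structure NDiword (X : Type*) where
  left : List X
  center : X
  right : List X

namespace NDiword

variable {X : Type*}

/-- The underlying (associative) word of a normal diword. -/
def word (u : NDiword X) : List X := u.left ++ u.center :: u.right

/-- Concatenation with center at the center of the second factor: the product `⊢`
on normal diwords. -/
def lconc (u v : NDiword X) : NDiword X := ⟨u.word ++ v.left, v.center, v.right⟩

/-- Concatenation with center at the center of the first factor: the product `⊣`
on normal diwords. -/
def rconc (u v : NDiword X) : NDiword X := ⟨u.left, u.center, u.right ++ v.word⟩

/-- The deg-lex order on normal diwords: compare `wt([u]) = (n+m+1, m, x₋ₘ, …, xₙ)`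
lexicographically. -/
def dlt [LinearOrder X] (u v : NDiword X) : Prop :=
  u.word.length < v.word.length ∨
    (u.word.length = v.word.length ∧
      (u.left.length < v.left.length ∨
        (u.left.length = v.left.length ∧ List.Lex (· < ·) u.word v.word)))

end NDiword

/-- The free dialgebra on `X` over `k`: the free `k`-vector space on the set of
normal diwords over `X`. -/
abbrev FreeDialg (k : Type*) [Field k] (X : Type*) := NDiword X →₀ k

/-- The one-letter normal diword `ẋ`, as an element of the free dialgebra. -/
noncomputable def ofX (k : Type*) [Field k] {X : Type*} (x : X) : FreeDialg k X :=
  Finsupp.single ⟨[], x, []⟩ 1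

section FreeDialgebra

variable {k : Type*} [Field k] {X : Type*}

/-- The product `⊢` on the free dialgebra, extended bilinearly from normal diwords. -/
noncomputable def lmul (f g : FreeDialg k X) : FreeDialg k X :=
  f.sum fun u a => g.sum fun v b => Finsupp.single (u.lconc v) (a * b)

/-- The product `⊣` on the free dialgebra, extended bilinearly from normal diwords. -/
noncomputable def rmul (f g : FreeDialg k X) : FreeDialg k X :=
  f.sum fun u a => g.sum fun v b => Finsupp.single (u.rconc v) (a * b)

/-- `x₁ ⊢ (x₂ ⊢ (⋯ ⊢ t))` for a word `a = x₁x₂⋯` of letters. -/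
noncomputable def lfold (a : List X) (t : FreeDialg k X) : FreeDialg k X :=
  a.foldr (fun x s => lmul (ofX k x) s) t

/-- `((t ⊣ x₁) ⊣ x₂) ⊣ ⋯` for a word `b = x₁x₂⋯` of letters. -/
noncomputable def rfold (t : FreeDialg k X) (b : List X) : FreeDialg k X :=
  b.foldl (fun s x => rmul s (ofX k x)) t

/-- `f` is left normed: every normal diword in its support has its center at the
last letter. -/
def LeftNormed (f : FreeDialg k X) : Prop := ∀ u ∈ f.support, u.right = ([] : List X)

/-- `f` is right normed: every normal diword in its support has its center at the
first letter. -/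
def RightNormed (f : FreeDialg k X) : Prop := ∀ u ∈ f.support, u.left = ([] : List X)

/-- `u` is the leading term (maximal term in the deg-lex order) of `f`. -/
def IsMaxTerm [LinearOrder X] (f : FreeDialg k X) (u : NDiword X) : Prop :=
  u ∈ f.support ∧ ∀ v ∈ f.support, v ≠ u → v.dlt u

/-- `f` is monic: its leading coefficient is `1`. -/
def Monic [LinearOrder X] (f : FreeDialg k X) : Prop :=
  ∃ u, IsMaxTerm f u ∧ f u = 1

/-- A context for an `s`-diword `[asb]`: a normal diword with one letter `x_k`
removed, where `s` is to be substituted.  `center a b` is the case `k = 0` (so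
`[asb] = a ⊢ ⋯ ⊢ s ⊣ ⋯ ⊣ b`); `left a w` is the case `k < 0` (so
`[asb] = a ⊢ ⋯ ⊢ s ⊢ [w]` with the center inside `w`); `right w b` is the case
`k > 0` (so `[asb] = [w] ⊣ s ⊣ ⋯ ⊣ b` with the center inside `w`). -/
inductive Ctx (X : Type*) where
  | center (a b : List X)
  | left (a : List X) (w : NDiword X)
  | right (w : NDiword X) (b : List X)

/-- The `s`-diword `[asb]` determined by a context: substitute `s` into the context. -/
noncomputable def Ctx.eval (s : FreeDialg k X) : Ctx X → FreeDialg k X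
  | Ctx.center a b => rfold (lfold a s) b
  | Ctx.left a w => lfold a (lmul s (Finsupp.single w 1))
  | Ctx.right w b => rfold (rmul (Finsupp.single w 1) s) b

/-- Substituting a normal diword `t` into a context gives a normal diword `[atb]`. -/
def Ctx.subst {X : Type*} (t : NDiword X) : Ctx X → NDiword X
  | Ctx.center a b => ⟨a ++ t.left, t.center, t.right ++ b⟩
  | Ctx.left a w => ⟨a ++ t.word ++ w.left, w.center, w.right⟩
  | Ctx.right w b => ⟨w.left, w.center, w.right ++ t.word ++ b⟩

/-- `[asb]` is a normal `s`-diword: either `s` sits at the center (`k = 0`), or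
`k < 0` and `s` is left normed, or `k > 0` and `s` is right normed. -/
def IsNormalFor (s : FreeDialg k X) : Ctx X → Prop
  | Ctx.center _ _ => True
  | Ctx.left _ _ => LeftNormed s
  | Ctx.right _ _ => RightNormed s

/-- Membership in the two-sided dialgebra ideal generated by `S`. -/
inductive IdealGen (S : Set (FreeDialg k X)) : FreeDialg k X → Prop
  | of {s : FreeDialg k X} : s ∈ S → IdealGen S s
  | zero : IdealGen S 0
  | add {f g : FreeDialg k X} : IdealGen S f → IdealGen S g → IdealGen S (f + g)
  | smul (r : k) {f : FreeDialg k X} : IdealGen S f → IdealGen S (r • f)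
  | lmul_left (g : FreeDialg k X) {f : FreeDialg k X} : IdealGen S f → IdealGen S (lmul g f)
  | lmul_right (g : FreeDialg k X) {f : FreeDialg k X} : IdealGen S f → IdealGen S (lmul f g)
  | rmul_left (g : FreeDialg k X) {f : FreeDialg k X} : IdealGen S f → IdealGen S (rmul g f)
  | rmul_right (g : FreeDialg k X) {f : FreeDialg k X} : IdealGen S f → IdealGen S (rmul f g)

/-- The two-sided dialgebra ideal `Id(S)` generated by `S`, as a submodule. -/
def dialgIdeal (S : Set (FreeDialg k X)) : Submodule k (FreeDialg k X) where
  carrier := {f | IdealGen S f}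
  add_mem' := fun hf hg => IdealGen.add hf hg
  zero_mem' := IdealGen.zero
  smul_mem' := fun r _ hf => IdealGen.smul r hf

end FreeDialgebra

section GSB

variable {k : Type*} [Field k] {X : Type*}

/-- `h` is a linear combination `Σᵢ αᵢ [aᵢsᵢbᵢ]` of `sᵢ`-diwords with `sᵢ ∈ S`, where
each pair `(sᵢ, [aᵢ⋅bᵢ])` satisfies the property `P`. -/
def IsCombination (S : Set (FreeDialg k X)) (h : FreeDialg k X)
    (P : FreeDialg k X → Ctx X → Prop) : Prop :=
  ∃ (n : ℕ) (α : Fin n → k) (s : Fin n → FreeDialg k X) (c : Fin n → Ctx X),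
    (∀ i, s i ∈ S) ∧ (∀ i, P (s i) (c i)) ∧
    h = ∑ i, α i • (c i).eval (s i)

/-- The composition of left multiplication `x ⊣ f` is trivial modulo `S`. -/
def TrivLMul [LinearOrder X] (S : Set (FreeDialg k X)) (x : X) (f : FreeDialg k X) : Prop :=
  IsCombination S (rmul (ofX k x) f) fun s c =>
    IsNormalFor s c ∧ RightNormed s ∧ RightNormed (c.eval s) ∧
      ∀ u m, IsMaxTerm s u → IsMaxTerm (rmul (ofX k x) f) m →
        (c.subst u).word.length ≤ m.word.length

/-- The composition of right multiplication `f ⊢ x` is trivial modulo `S`. -/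
def TrivRMul [LinearOrder X] (S : Set (FreeDialg k X)) (x : X) (f : FreeDialg k X) : Prop :=
  IsCombination S (lmul f (ofX k x)) fun s c =>
    IsNormalFor s c ∧ LeftNormed s ∧ LeftNormed (c.eval s) ∧
      ∀ u m, IsMaxTerm s u → IsMaxTerm (lmul f (ofX k x)) m →
        (c.subst u).word.length ≤ m.word.length

/-- All compositions of left multiplication in `S` are trivial modulo `S`. -/
def LMulCompsTrivial [LinearOrder X] (S : Set (FreeDialg k X)) : Prop :=
  ∀ f ∈ S, ¬ RightNormed f → ∀ x : X, TrivLMul S x f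

/-- All compositions of right multiplication in `S` are trivial modulo `S`. -/
def RMulCompsTrivial [LinearOrder X] (S : Set (FreeDialg k X)) : Prop :=
  ∀ f ∈ S, ¬ LeftNormed f → ∀ x : X, TrivRMul S x f

/-- `h` is trivial modulo `(S, [w])`: it is a combination of normal `S`-diwords with
leading normal diwords `< [w]`; moreover all the summands are right (resp. left)
normed `S`-diwords whenever the side condition `rn` (resp. `ln`) holds. -/
def TrivBelowWith [LinearOrder X] (S : Set (FreeDialg k X)) (h : FreeDialg k X)
    (w : NDiword X) (rn ln : Prop) : Prop :=
  IsCombination S h fun s c =>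
    IsNormalFor s c ∧ (∀ u, IsMaxTerm s u → (c.subst u).dlt w) ∧
      (rn → RightNormed s ∧ RightNormed (c.eval s)) ∧
      (ln → LeftNormed s ∧ LeftNormed (c.eval s))

/-- All compositions of inclusion among elements of `S` are trivial. -/
def InclCompsTrivial [LinearOrder X] (S : Set (FreeDialg k X)) : Prop :=
  ∀ f ∈ S, ∀ g ∈ S, ∀ (fb gb : NDiword X) (c : Ctx X),
    IsMaxTerm f fb → IsMaxTerm g gb → IsNormalFor g c → fb = c.subst gb →
      TrivBelowWith S (f - c.eval g) fb
        (RightNormed f ∧ RightNormed g ∧ RightNormed (c.eval g))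
        (LeftNormed f ∧ LeftNormed g ∧ LeftNormed (c.eval g))

/-- A context with no letters before the substituted polynomial (shape `[fb]`). -/
def Ctx.noLeft {X : Type*} : Ctx X → Prop
  | Ctx.center a _ => a = []
  | Ctx.left a _ => a = []
  | Ctx.right _ _ => False

/-- A context with no letters after the substituted polynomial (shape `[ag]`). -/
def Ctx.noRight {X : Type*} : Ctx X → Prop
  | Ctx.center _ b => b = []
  | Ctx.right _ b => b = []
  | Ctx.left _ _ => False

/-- All compositions of intersection among elements of `S` are trivial. -/
def IntersectCompsTrivial [LinearOrder X] (S : Set (FreeDialg k X)) : Prop :=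
  ∀ f ∈ S, ∀ g ∈ S, ∀ (fb gb : NDiword X) (cf cg : Ctx X),
    IsMaxTerm f fb → IsMaxTerm g gb → IsNormalFor f cf → IsNormalFor g cg →
    cf.noLeft → cg.noRight → cf.subst fb = cg.subst gb →
    (cf.subst fb).word.length < fb.word.length + gb.word.length →
      TrivBelowWith S (cf.eval f - cg.eval g) (cf.subst fb)
        (RightNormed f ∧ RightNormed g ∧ RightNormed (cf.eval f) ∧ RightNormed (cg.eval g))
        (LeftNormed f ∧ LeftNormed g ∧ LeftNormed (cf.eval f) ∧ LeftNormed (cg.eval g))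

/-- `S` is a Gröbner–Shirshov basis in the free dialgebra: `S` is monic and all
compositions (left multiplication, right multiplication, inclusion, intersection)
of elements of `S` are trivial. -/
def IsGSB [LinearOrder X] (S : Set (FreeDialg k X)) : Prop :=
  (∀ f ∈ S, Monic f) ∧ LMulCompsTrivial S ∧ RMulCompsTrivial S ∧
    InclCompsTrivial S ∧ IntersectCompsTrivial S

/-- `Irr(S)`: the normal diwords that are not of the form `[a[s̄]b]` for any `s ∈ S`
and normal `s`-diword `[asb]`. -/
def IrrSet [LinearOrder X] (S : Set (FreeDialg k X)) : Set (NDiword X) :=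
  {u | ¬ ∃ s ∈ S, ∃ (c : Ctx X) (sb : NDiword X),
    IsMaxTerm s sb ∧ IsNormalFor s c ∧ u = c.subst sb}

end GSB

section Aux

variable {k : Type*} [Field k] {X : Type*}

theorem lmul_single_left (u : NDiword X) (g : FreeDialg k X) :
    lmul (Finsupp.single u 1) g = Finsupp.mapDomain (fun t => u.lconc t) g := by
  unfold lmul
  rw [Finsupp.sum_single_index] <;> simp [Finsupp.mapDomain]

theorem lmul_single_right (u : NDiword X) (g : FreeDialg k X) :
    lmul g (Finsupp.single u 1) = Finsupp.mapDomain (fun t => t.lconc u) g := by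
  unfold lmul
  rw [Finsupp.mapDomain]
  refine Finsupp.sum_congr fun x _ => ?_
  rw [Finsupp.sum_single_index] <;> simp

theorem rmul_single_left (u : NDiword X) (g : FreeDialg k X) :
    rmul (Finsupp.single u 1) g = Finsupp.mapDomain (fun t => u.rconc t) g := by
  unfold rmul
  rw [Finsupp.sum_single_index] <;> simp [Finsupp.mapDomain]

theorem rmul_single_right (u : NDiword X) (g : FreeDialg k X) :
    rmul g (Finsupp.single u 1) = Finsupp.mapDomain (fun t => t.rconc u) g := by
  unfold rmul
  rw [Finsupp.mapDomain]
  refine Finsupp.sum_congr fun x _ => ?_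
  rw [Finsupp.sum_single_index] <;> simp

theorem lfold_eq (a : List X) (t : FreeDialg k X) :
    lfold a t = Finsupp.mapDomain (fun u : NDiword X => ⟨a ++ u.left, u.center, u.right⟩) t := by
  induction a with
  | nil => exact (Finsupp.mapDomain_id).symm
  | cons x a ih =>
    have : lfold (x :: a) t = lmul (ofX k x) (lfold a t) := rfl
    rw [this, ih, ofX, lmul_single_left, ← Finsupp.mapDomain_comp]
    congr 1

theorem rfold_eq (b : List X) (t : FreeDialg k X) :
    rfold t b = Finsupp.mapDomain (fun u : NDiword X => ⟨u.left, u.center, u.right ++ b⟩) t := by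
  induction b generalizing t with
  | nil =>
    simp only [List.append_nil]
    exact (Finsupp.mapDomain_id).symm
  | cons x b ih =>
    have : rfold t (x :: b) = rfold (rmul t (ofX k x)) b := rfl
    rw [this, ih, ofX, rmul_single_right, ← Finsupp.mapDomain_comp]
    congr 1
    funext u
    simp [NDiword.rconc, NDiword.word]

/-- evaluation of a context as a linear map -/
noncomputable def ev (c : Ctx X) : FreeDialg k X →ₗ[k] FreeDialg k X :=
  Finsupp.lmapDomain k k (fun t => c.subst t)

theorem ev_single (c : Ctx X) (u : NDiword X) (r : k) :
    ev c (Finsupp.single u r) = Finsupp.single (c.subst u) r := by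
  simp [ev, Finsupp.mapDomain_single]

theorem eval_eq (c : Ctx X) (s : FreeDialg k X) : c.eval s = ev c s := by
  cases c with
  | center a b =>
    simp only [Ctx.eval, ev, lfold_eq, rfold_eq, ← Finsupp.mapDomain_comp, Finsupp.lmapDomain_apply]
    congr 1
  | left a w =>
    simp only [Ctx.eval, ev, lfold_eq, lmul_single_right, ← Finsupp.mapDomain_comp,
      Finsupp.lmapDomain_apply]
    congr 1
    funext u
    simp [NDiword.lconc, NDiword.word, Ctx.subst]
  | right w b =>
    simp only [Ctx.eval, ev, rfold_eq, rmul_single_left, ← Finsupp.mapDomain_comp,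
      Finsupp.lmapDomain_apply]
    congr 1

theorem ev_support (c : Ctx X) (s : FreeDialg k X) (v : NDiword X) (hv : v ∈ (ev c s).support) :
    ∃ u ∈ s.support, c.subst u = v := by
  classical
  have := Finsupp.mapDomain_support hv
  simpa using this

/-- composition of contexts -/
def Ctx.comp : Ctx X → Ctx X → Ctx X
  | .center a b, .center a' b' => .center (a ++ a') (b' ++ b)
  | .center a b, .left a' w => .left (a ++ a') ⟨w.left, w.center, w.right ++ b⟩
  | .center a b, .right w b' => .right ⟨a ++ w.left, w.center, w.right⟩ (b' ++ b)
  | .left a w, .center a' b' => .left (a ++ a') ⟨b' ++ w.left, w.center, w.right⟩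
  | .left a w, .left a' w' => .left (a ++ a') (w'.lconc w)
  | .left a w, .right w' b' => .left (a ++ w'.word) ⟨b' ++ w.left, w.center, w.right⟩
  | .right w b, .center a' b' => .right ⟨w.left, w.center, w.right ++ a'⟩ (b' ++ b)
  | .right w b, .left a' w' => .right ⟨w.left, w.center, w.right ++ a'⟩ (w'.word ++ b)
  | .right w b, .right w' b' => .right (w.rconc w') (b' ++ b)

theorem comp_subst (o i : Ctx X) (t : NDiword X) :
    (o.comp i).subst t = o.subst (i.subst t) := by
  cases o <;> cases i <;>
    simp [Ctx.comp, Ctx.subst, NDiword.word, NDiword.lconc, NDiword.rconc]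

theorem ev_congr {c o i : Ctx X} (h : ∀ t, c.subst t = o.subst (i.subst t)) (s : FreeDialg k X) :
    ev c s = ev o (ev i s) := by
  simp only [ev, Finsupp.lmapDomain_apply, ← Finsupp.mapDomain_comp]
  congr 1
  funext t
  exact h t

theorem ev_comp (o i : Ctx X) (s : FreeDialg k X) : ev (o.comp i) s = ev o (ev i s) :=
  ev_congr (comp_subst o i) s

/-- side condition for the outer context -/
def Ctx.side (P Q : Prop) : Ctx X → Prop
  | .center _ _ => True
  | .left _ _ => P
  | .right _ _ => Q

theorem normal_comp (o i : Ctx X) (s : FreeDialg k X) (hi : IsNormalFor s i)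
    (h : o.side (LeftNormed s) (RightNormed s)) : IsNormalFor s (o.comp i) := by
  cases o <;> cases i <;> simp_all [Ctx.side, Ctx.comp, IsNormalFor]

/-- span of the normal S-diwords -/
noncomputable def NS (S : Set (FreeDialg k X)) : Submodule k (FreeDialg k X) :=
  Submodule.span k {h | ∃ s ∈ S, ∃ c : Ctx X, IsNormalFor s c ∧ h = ev c s}

theorem combo_mem (S : Set (FreeDialg k X)) (h : FreeDialg k X)
    (P : FreeDialg k X → Ctx X → Prop) (hc : IsCombination S h P) (o : Ctx X)
    (N : Submodule k (FreeDialg k X)) (hN : ∀ s ∈ S, ∀ c, P s c → ev (o.comp c) s ∈ N) :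
    ev o h ∈ N := by
  obtain ⟨n, α, s, c, hs, hP, rfl⟩ := hc
  rw [map_sum]
  refine Submodule.sum_mem _ fun i _ => ?_
  rw [map_smul, eval_eq, ← ev_comp]
  exact N.smul_mem _ (hN _ (hs i) _ (hP i))

theorem ev_mem_NS [LinearOrder X] (S : Set (FreeDialg k X)) (hgsb : IsGSB S)
    (s : FreeDialg k X) (hs : s ∈ S) (c : Ctx X) : ev c s ∈ NS S := by
  have key : ∀ c, IsNormalFor s c → ev c s ∈ NS S := fun c hc =>
    Submodule.subset_span ⟨s, hs, c, hc, rfl⟩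
  obtain ⟨-, hL, hR, -, -⟩ := hgsb
  cases c with
  | center a b => exact key _ trivial
  | left a w =>
    by_cases hn : LeftNormed s
    · exact key _ hn
    obtain ⟨l, y, r⟩ := w
    cases l with
    | nil =>
      have : ev (Ctx.left a ⟨[], y, r⟩) s = ev (Ctx.center a r) (lmul s (ofX k y)) := by
        rw [ofX, lmul_single_right]
        have := ev_congr (k := k) (c := Ctx.left a ⟨[], y, r⟩) (o := Ctx.center a r)
          (i := Ctx.left [] ⟨[], y, []⟩) (fun t => by simp [Ctx.subst]) s
        rw [this]; congr 1
      rw [this]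
      refine combo_mem S _ _ (hR s hs hn y) _ _ ?_
      rintro t ht c ⟨h1, h2, -⟩
      exact Submodule.subset_span ⟨t, ht, _, normal_comp _ _ _ h1 (by exact trivial), rfl⟩
    | cons x l =>
      have : ev (Ctx.left a ⟨x :: l, y, r⟩) s = ev (Ctx.left a ⟨l, y, r⟩) (lmul s (ofX k x)) := by
        rw [ofX, lmul_single_right]
        have := ev_congr (k := k) (c := Ctx.left a ⟨x :: l, y, r⟩) (o := Ctx.left a ⟨l, y, r⟩)
          (i := Ctx.left [] ⟨[], x, []⟩) (fun t => by simp [Ctx.subst, NDiword.word]) s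
        rw [this]; congr 1
      rw [this]
      refine combo_mem S _ _ (hR s hs hn x) _ _ ?_
      rintro t ht c ⟨h1, h2, -⟩
      exact Submodule.subset_span ⟨t, ht, _, normal_comp _ _ _ h1 (by exact h2), rfl⟩
  | right w b =>
    by_cases hn : RightNormed s
    · exact key _ hn
    obtain ⟨l, y, r⟩ := w
    rcases List.eq_nil_or_concat' r with rfl | ⟨r, x, rfl⟩
    · have : ev (Ctx.right ⟨l, y, []⟩ b) s = ev (Ctx.center l b) (rmul (ofX k y) s) := by
        rw [ofX, rmul_single_left]
        have := ev_congr (k := k) (c := Ctx.right ⟨l, y, []⟩ b) (o := Ctx.center l b)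
          (i := Ctx.right ⟨[], y, []⟩ []) (fun t => by simp [Ctx.subst]) s
        rw [this]
        simp [ev, Ctx.subst, NDiword.rconc]
      rw [this]
      refine combo_mem S _ _ (hL s hs hn y) _ _ ?_
      rintro t ht c ⟨h1, h2, -⟩
      exact Submodule.subset_span ⟨t, ht, _, normal_comp _ _ _ h1 (by exact trivial), rfl⟩
    · have : ev (Ctx.right ⟨l, y, r ++ [x]⟩ b) s
          = ev (Ctx.right ⟨l, y, r⟩ b) (rmul (ofX k x) s) := by
        rw [ofX, rmul_single_left]
        have := ev_congr (k := k) (c := Ctx.right ⟨l, y, r ++ [x]⟩ b) (o := Ctx.right ⟨l, y, r⟩ b)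
          (i := Ctx.right ⟨[], x, []⟩ []) (fun t => by simp [Ctx.subst, NDiword.word]) s
        rw [this]
        simp [ev, Ctx.subst, NDiword.rconc]
      rw [this]
      refine combo_mem S _ _ (hL s hs hn x) _ _ ?_
      rintro t ht c ⟨h1, h2, -⟩
      exact Submodule.subset_span ⟨t, ht, _, normal_comp _ _ _ h1 (by exact h2), rfl⟩

theorem ev_NS [LinearOrder X] (S : Set (FreeDialg k X)) (hgsb : IsGSB S)
    (f : FreeDialg k X) (hf : f ∈ NS S) (o : Ctx X) : ev o f ∈ NS S := by
  unfold NS at hf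
  induction hf using Submodule.span_induction with
  | mem x hx =>
    obtain ⟨s, hs, c, -, rfl⟩ := hx
    rw [← ev_comp]
    exact ev_mem_NS S hgsb s hs _
  | zero => simp
  | add x y _ _ hx hy => rw [map_add]; exact add_mem hx hy
  | smul r x _ hx => rw [map_smul]; exact Submodule.smul_mem _ _ hx

theorem lmul_eq_sum_left (g f : FreeDialg k X) :
    lmul g f = g.sum fun u a => a • ev (Ctx.center u.word []) f := by
  unfold lmul
  refine Finsupp.sum_congr fun u _ => ?_
  rw [ev, Finsupp.lmapDomain_apply, Finsupp.mapDomain, Finsupp.smul_sum]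
  refine Finsupp.sum_congr fun v _ => ?_
  simp [Ctx.subst, NDiword.lconc]

theorem rmul_eq_sum_left (g f : FreeDialg k X) :
    rmul g f = g.sum fun u a => a • ev (Ctx.right u []) f := by
  unfold rmul
  refine Finsupp.sum_congr fun u _ => ?_
  rw [ev, Finsupp.lmapDomain_apply, Finsupp.mapDomain, Finsupp.smul_sum]
  refine Finsupp.sum_congr fun v _ => ?_
  simp [Ctx.subst, NDiword.rconc]

theorem lmul_eq_sum_right (g f : FreeDialg k X) :
    lmul f g = g.sum fun u a => a • ev (Ctx.left [] u) f := by
  unfold lmul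
  rw [Finsupp.sum_comm]
  refine Finsupp.sum_congr fun u _ => ?_
  rw [ev, Finsupp.lmapDomain_apply, Finsupp.mapDomain, Finsupp.smul_sum]
  refine Finsupp.sum_congr fun v _ => ?_
  simp [Ctx.subst, NDiword.lconc, mul_comm]

theorem rmul_eq_sum_right (g f : FreeDialg k X) :
    rmul f g = g.sum fun u a => a • ev (Ctx.center [] u.word) f := by
  unfold rmul
  rw [Finsupp.sum_comm]
  refine Finsupp.sum_congr fun u _ => ?_
  rw [ev, Finsupp.lmapDomain_apply, Finsupp.mapDomain, Finsupp.smul_sum]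
  refine Finsupp.sum_congr fun v _ => ?_
  simp [Ctx.subst, NDiword.rconc, mul_comm]

theorem ideal_le_NS [LinearOrder X] (S : Set (FreeDialg k X)) (hgsb : IsGSB S)
    (f : FreeDialg k X) (hf : IdealGen S f) : f ∈ NS S := by
  have sm : ∀ (g f : FreeDialg k X) (c : NDiword X → Ctx X), f ∈ NS S →
      (g.sum fun u a => a • ev (c u) f) ∈ NS S := fun g f c hf =>
    Submodule.sum_mem _ fun u _ => Submodule.smul_mem _ _ (ev_NS S hgsb f hf _)
  induction hf with
  | @of s hs =>
    refine Submodule.subset_span ⟨s, hs, Ctx.center [] [], trivial, ?_⟩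
    rw [← eval_eq]; rfl
  | zero => exact zero_mem _
  | add _ _ h1 h2 => exact add_mem h1 h2
  | smul r _ h => exact Submodule.smul_mem _ _ h
  | lmul_left g _ h => rw [lmul_eq_sum_left]; exact sm _ _ (fun u => Ctx.center u.word []) h
  | lmul_right g _ h => rw [lmul_eq_sum_right]; exact sm _ _ (fun u => Ctx.left [] u) h
  | rmul_left g _ h => rw [rmul_eq_sum_left]; exact sm _ _ (fun u => Ctx.right u []) h
  | rmul_right g _ h => rw [rmul_eq_sum_right]; exact sm _ _ (fun u => Ctx.center [] u.word) h

section Order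

variable [LinearOrder X]

/-- weight of a diword -/
def wt (u : NDiword X) : ℕ ×ₗ ℕ ×ₗ List X :=
  toLex (u.word.length, toLex (u.left.length, u.word))

theorem dlt_iff (u v : NDiword X) : u.dlt v ↔ wt u < wt v := by
  simp only [NDiword.dlt, wt, Prod.Lex.toLex_lt_toLex]
  rfl

theorem wt_inj {u v : NDiword X} (h : wt u = wt v) : u = v := by
  simp only [wt, EmbeddingLike.apply_eq_iff_eq, Prod.mk.injEq] at h
  obtain ⟨-, h2, h3⟩ := h
  obtain ⟨l, c, r⟩ := u
  obtain ⟨l', c', r'⟩ := v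
  have := List.append_inj h3 h2
  simp_all

theorem dlt_wf [WellFoundedLT X] : WellFounded (NDiword.dlt (X := X)) := by
  have h1 : WellFounded (fun a b : X => a < b) := wellFounded_lt
  have h2 := (List.Shortlex.wf h1)
  have h3 : WellFounded (Prod.Lex (fun a b : ℕ => a < b) (Prod.Lex (fun a b : ℕ => a < b)
    (List.Shortlex (fun a b : X => a < b)))) :=
    WellFounded.prod_lex wellFounded_lt (WellFounded.prod_lex wellFounded_lt h2)
  refine Subrelation.wf ?_ (InvImage.wf (fun u : NDiword X =>
    (u.word.length, (u.left.length, u.word))) h3)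
  intro u v h
  simp only [InvImage, Prod.lex_def, List.shortlex_def]
  rcases h with h | ⟨h, h' | ⟨h', h''⟩⟩
  · exact Or.inl h
  · exact Or.inr ⟨h, Or.inl h'⟩
  · exact Or.inr ⟨h, Or.inr ⟨h', Or.inr ⟨h, h''⟩⟩⟩

theorem lex_append_right {l l' : List X} (b : List X) (hl : l.length = l'.length)
    (h : List.Lex (· < ·) l l') : List.Lex (· < ·) (l ++ b) (l' ++ b) := by
  induction h with
  | nil => simp at hl
  | cons _ ih => exact List.Lex.cons (ih (by simpa using hl))
  | rel h => exact List.Lex.rel h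

theorem word_subst (c : Ctx X) : ∃ p q : List X, ∀ t, (c.subst t).word = p ++ t.word ++ q := by
  cases c with
  | center a b => exact ⟨a, b, fun t => by simp [Ctx.subst, NDiword.word]⟩
  | left a w => exact ⟨a, w.word, fun t => by simp [Ctx.subst, NDiword.word]⟩
  | right w b => exact ⟨w.word, b, fun t => by simp [Ctx.subst, NDiword.word]⟩

theorem subst_mono (c : Ctx X) (u v : NDiword X)
    (hc : c.side (u.right = [] ∧ v.right = []) (u.left = [] ∧ v.left = []))
    (h : u.dlt v) : (c.subst u).dlt (c.subst v) := by
  obtain ⟨p, q, hw⟩ := word_subst c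
  unfold NDiword.dlt at h ⊢
  rw [hw, hw]
  rcases h with h | ⟨h1, h⟩
  · left; simpa using h
  right
  refine ⟨by simp [h1], ?_⟩
  have hlex : List.Lex (· < ·) u.word v.word →
      List.Lex (· < ·) (p ++ u.word ++ q) (p ++ v.word ++ q) := fun h =>
    lex_append_right _ (by simp [h1]) (List.Lex.append_left _ h p)
  cases c with
  | center a b =>
    rcases h with h | ⟨h, h'⟩
    · left; simpa [Ctx.subst] using h
    · right; exact ⟨by simpa [Ctx.subst] using h, hlex h'⟩
  | left a w =>
    obtain ⟨h2, h3⟩ := hc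
    have hl : u.left.length = v.left.length := by
      simpa [NDiword.word, h2, h3] using h1
    rcases h with h | ⟨h, h'⟩
    · omega
    · right; exact ⟨by simp [Ctx.subst, h1], hlex h'⟩
  | right w b =>
    obtain ⟨h2, h3⟩ := hc
    rcases h with h | ⟨h, h'⟩
    · simp [h2, h3] at h
    · right; exact ⟨by simp [Ctx.subst], hlex h'⟩

theorem normal_mono (s : FreeDialg k X) (c : Ctx X) (hc : IsNormalFor s c) (sb : NDiword X)
    (hsb : IsMaxTerm s sb) (u : NDiword X) (hu : u ∈ s.support) (hne : u ≠ sb) :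
    (c.subst u).dlt (c.subst sb) := by
  refine subst_mono c u sb ?_ (hsb.2 u hu hne)
  cases c with
  | center a b => trivial
  | left a w => exact ⟨hc u hu, hc sb hsb.1⟩
  | right w b => exact ⟨hc u hu, hc sb hsb.1⟩

theorem dlt_asymm {u v : NDiword X} (h : u.dlt v) (h' : v.dlt u) : False := by
  rw [dlt_iff] at h h'
  exact lt_asymm h h'

theorem max_unique {s : FreeDialg k X} {u v : NDiword X} (hu : IsMaxTerm s u)
    (hv : IsMaxTerm s v) : u = v := by
  by_contra hne
  exact dlt_asymm (hv.2 u hu.1 hne) (hu.2 v hv.1 (Ne.symm hne))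

theorem ev_lead (s : FreeDialg k X) (c : Ctx X) (hc : IsNormalFor s c) (sb : NDiword X)
    (hsb : IsMaxTerm s sb) (h1 : s sb = 1) :
    ev c s (c.subst sb) = 1 ∧ ∀ v ∈ (ev c s).support, v ≠ c.subst sb → v.dlt (c.subst sb) := by
  classical
  constructor
  · have : ev c s (c.subst sb) = ∑ u ∈ s.support, (Finsupp.single (c.subst u) (s u)) (c.subst sb) := by
      rw [ev, Finsupp.lmapDomain_apply, Finsupp.mapDomain, Finsupp.sum, Finsupp.finsetSum_apply]
    rw [this, Finset.sum_eq_single sb]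
    · simp [h1]
    · intro u hu hne
      have := normal_mono s c hc sb hsb u hu hne
      rw [Finsupp.single_apply, if_neg]
      intro h
      rw [h] at this
      exact dlt_asymm this this
    · intro h; exact absurd hsb.1 h
  · intro v hv hne
    obtain ⟨u, hu, rfl⟩ := ev_support c s v hv
    exact normal_mono s c hc sb hsb u hu (fun h => hne (by rw [h]))

/-- span of the normal S-diwords with leading term below w -/
noncomputable def NB (S : Set (FreeDialg k X)) (w : NDiword X) : Submodule k (FreeDialg k X) :=
  Submodule.span k {h | ∃ s ∈ S, ∃ c : Ctx X, IsNormalFor s c ∧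
    (∀ u, IsMaxTerm s u → (c.subst u).dlt w) ∧ h = ev c s}

theorem triv_mem (S : Set (FreeDialg k X)) (hm : ∀ f ∈ S, Monic f)
    (h : FreeDialg k X) (w : NDiword X) (rn ln : Prop)
    (ht : TrivBelowWith S h w rn ln) (o : Ctx X)
    (ho : o.side (ln ∧ w.right = []) (rn ∧ w.left = [])) : ev o h ∈ NB S (o.subst w) := by
  refine combo_mem S h _ ht o _ ?_
  rintro s hs c ⟨h1, h2, h3, h4⟩
  refine Submodule.subset_span ⟨s, hs, _, normal_comp o c s h1 ?_, ?_, rfl⟩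
  · cases o with
    | center a b => trivial
    | left a v => exact (h4 ho.1).1
    | right v b => exact (h3 ho.1).1
  · intro u hu
    obtain ⟨u', hu', hu1⟩ := hm s hs
    obtain rfl := max_unique hu hu'
    rw [comp_subst]
    have hsup : c.subst u ∈ (c.eval s).support := by
      rw [eval_eq, Finsupp.mem_support_iff, (ev_lead s c h1 u hu hu1).1]
      exact one_ne_zero
    refine subst_mono o _ _ ?_ (h2 u hu)
    cases o with
    | center a b => trivial
    | left a v => exact ⟨(h4 ho.1).2 _ hsup, ho.2⟩
    | right v b => exact ⟨(h3 ho.1).2 _ hsup, ho.2⟩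

/-- The disjoint case. -/
theorem disj_mem (S : Set (FreeDialg k X)) {f g : FreeDialg k X}
    (hf : f ∈ S) (hg : g ∈ S) {fb gb : NDiword X} (hfb : IsMaxTerm f fb) (hgb : IsMaxTerm g gb)
    (hf1 : f fb = 1) (hg1 : g gb = 1) (F G : NDiword X → Ctx X)
    (hF : ∀ v, IsNormalFor f (F v)) (hG : ∀ u, IsNormalFor g (G u))
    (hFG : ∀ u v, (F v).subst u = (G u).subst v) :
    ev (F gb) f - ev (G fb) g ∈ NB S ((F gb).subst fb) := by
  classical
  have e1 : (f.sum fun u a => a • ev (G u) g) = g.sum fun v b => b • ev (F v) f := by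
    have : ∀ u a, a • ev (G u) g = g.sum fun v b => Finsupp.single ((G u).subst v) (a * b) := by
      intro u a
      rw [ev, Finsupp.lmapDomain_apply, Finsupp.mapDomain, Finsupp.smul_sum]
      simp
    simp only [this]
    rw [Finsupp.sum_comm]
    refine Finsupp.sum_congr fun v _ => ?_
    rw [ev, Finsupp.lmapDomain_apply, Finsupp.mapDomain, Finsupp.smul_sum]
    refine Finsupp.sum_congr fun u _ => ?_
    simp [hFG, mul_comm]
  rw [Finsupp.sum, Finsupp.sum, ← Finset.add_sum_erase _ _ hfb.1,
    ← Finset.add_sum_erase _ _ hgb.1, hf1, hg1, one_smul, one_smul] at e1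
  have e2 : ev (F gb) f - ev (G fb) g = (∑ u ∈ f.support.erase fb, f u • ev (G u) g)
      - ∑ v ∈ g.support.erase gb, g v • ev (F v) f := by
    rw [sub_eq_sub_iff_add_eq_add, ← e1, add_comm]
  rw [e2]
  refine sub_mem (Submodule.sum_mem _ fun u hu => Submodule.smul_mem _ _ ?_)
    (Submodule.sum_mem _ fun v hv => Submodule.smul_mem _ _ ?_)
  · refine Submodule.subset_span ⟨g, hg, G u, hG u, fun z hz => ?_, rfl⟩
    obtain rfl := max_unique hz hgb
    rw [← hFG]
    exact normal_mono f _ (hF _) fb hfb u (Finset.mem_of_mem_erase hu) (Finset.ne_of_mem_erase hu)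
  · refine Submodule.subset_span ⟨f, hf, F v, hF v, fun z hz => ?_, rfl⟩
    obtain rfl := max_unique hz hfb
    rw [hFG, hFG]
    exact normal_mono g _ (hG _) gb hgb v (Finset.mem_of_mem_erase hv) (Finset.ne_of_mem_erase hv)

theorem ev_leftNormed {f : FreeDialg k X} (c : Ctx X) (hf : LeftNormed f)
    (hc : ∀ t : NDiword X, t.right = [] → (c.subst t).right = []) : LeftNormed (c.eval f) := by
  intro u hu
  rw [eval_eq] at hu
  obtain ⟨t, ht, rfl⟩ := ev_support c f u hu
  exact hc t (hf t ht)

theorem ev_rightNormed {f : FreeDialg k X} (c : Ctx X) (hf : RightNormed f)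
    (hc : ∀ t : NDiword X, t.left = [] → (c.subst t).left = []) : RightNormed (c.eval f) := by
  intro u hu
  rw [eval_eq] at hu
  obtain ⟨t, ht, rfl⟩ := ev_support c f u hu
  exact hc t (hf t ht)

theorem incl_mem {S : Set (FreeDialg k X)} (hS : IsGSB S) {f g : FreeDialg k X}
    (hf : f ∈ S) (hg : g ∈ S) {fb gb : NDiword X} (hfb : IsMaxTerm f fb) (hgb : IsMaxTerm g gb)
    {cf cg : Ctx X} (hcf : IsNormalFor f cf) (c' : Ctx X)
    (h1 : ∀ t, cg.subst t = cf.subst (c'.subst t)) (h2 : IsNormalFor g c') (h3 : fb = c'.subst gb)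
    (h4 : cf.side (LeftNormed g ∧ ∀ t : NDiword X, t.right = [] → (c'.subst t).right = [])
      (RightNormed g ∧ ∀ t : NDiword X, t.left = [] → (c'.subst t).left = [])) :
    ev cf f - ev cg g ∈ NB S (cf.subst fb) := by
  have e : ev cf f - ev cg g = ev cf (f - c'.eval g) := by
    rw [map_sub, eval_eq, ev_congr h1]
  rw [e]
  refine triv_mem S hS.1 _ _ _ _ (hS.2.2.2.1 f hf g hg fb gb c' hfb hgb h2 h3) cf ?_
  cases cf with
  | center a b => trivial
  | left a w => exact ⟨⟨hcf, h4.1, ev_leftNormed _ h4.1 h4.2⟩, hcf _ hfb.1⟩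
  | right w b => exact ⟨⟨hcf, h4.1, ev_rightNormed _ h4.1 h4.2⟩, hcf _ hfb.1⟩

theorem inter_mem {S : Set (FreeDialg k X)} (hS : IsGSB S) {f g : FreeDialg k X}
    (hf : f ∈ S) (hg : g ∈ S) {fb gb : NDiword X} (hfb : IsMaxTerm f fb) (hgb : IsMaxTerm g gb)
    {cf cg : Ctx X} (o cf' cg' : Ctx X)
    (h1 : ∀ t, cf.subst t = o.subst (cf'.subst t)) (h1' : ∀ t, cg.subst t = o.subst (cg'.subst t))
    (h2 : IsNormalFor f cf') (h2' : IsNormalFor g cg') (hl : cf'.noLeft) (hr : cg'.noRight)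
    (h3 : cf'.subst fb = cg'.subst gb)
    (h4 : (cf'.subst fb).word.length < fb.word.length + gb.word.length)
    (h5 : o.side (LeftNormed f ∧ LeftNormed g ∧ ∀ t : NDiword X, t.right = [] →
        (cf'.subst t).right = [] ∧ (cg'.subst t).right = [])
      (RightNormed f ∧ RightNormed g ∧ ∀ t : NDiword X, t.left = [] →
        (cf'.subst t).left = [] ∧ (cg'.subst t).left = [])) :
    ev cf f - ev cg g ∈ NB S (cf.subst fb) := by
  have e : ev cf f - ev cg g = ev o (cf'.eval f - cg'.eval g) := by
    rw [map_sub, eval_eq, eval_eq, ev_congr h1, ev_congr h1']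
  rw [e, h1]
  refine triv_mem S hS.1 _ _ _ _
    (hS.2.2.2.2 f hf g hg fb gb cf' cg' hfb hgb h2 h2' hl hr h3 h4) o ?_
  cases o with
  | center a b => trivial
  | left a w =>
    obtain ⟨a1, a2, a3⟩ := h5
    exact ⟨⟨a1, a2, ev_leftNormed _ a1 fun t ht => (a3 t ht).1,
      ev_leftNormed _ a2 fun t ht => (a3 t ht).2⟩, (a3 _ (a1 _ hfb.1)).1⟩
  | right w b =>
    obtain ⟨a1, a2, a3⟩ := h5
    exact ⟨⟨a1, a2, ev_rightNormed _ a1 fun t ht => (a3 t ht).1,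
      ev_rightNormed _ a2 fun t ht => (a3 t ht).2⟩, (a3 _ (a1 _ hfb.1)).1⟩

theorem swap_mem {S : Set (FreeDialg k X)} {f g : FreeDialg k X} {fb gb : NDiword X}
    {cf cg : Ctx X} (h : cf.subst fb = cg.subst gb)
    (hm : ev cg g - ev cf f ∈ NB S (cg.subst gb)) :
    ev cf f - ev cg g ∈ NB S (cf.subst fb) := by
  rw [h, ← neg_sub]
  exact neg_mem hm

section Cases

variable {S : Set (FreeDialg k X)} {f g : FreeDialg k X} {fb gb : NDiword X}

theorem key_CC' (hS : IsGSB S) (hf : f ∈ S) (hg : g ∈ S) (hfb : IsMaxTerm f fb)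
    (hgb : IsMaxTerm g gb) (a e b b' : List X)
    (h : (Ctx.center a b).subst fb = (Ctx.center (a ++ e) b').subst gb) :
    ev (Ctx.center a b) f - ev (Ctx.center (a ++ e) b') g ∈ NB S ((Ctx.center a b).subst fb) := by
  obtain ⟨fl, fc, fr⟩ := fb
  obtain ⟨gl, gc, gr⟩ := gb
  simp only [Ctx.subst, NDiword.mk.injEq, List.append_assoc, List.append_cancel_left_eq] at h
  obtain ⟨rfl, rfl, h⟩ := h
  rcases List.append_eq_append_iff.1 h with ⟨m, rfl, rfl⟩ | ⟨m, rfl, rfl⟩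
  · exact inter_mem hS hf hg hfb hgb (Ctx.center a b') (Ctx.center [] m) (Ctx.center e [])
      (by simp [Ctx.subst]) (by simp [Ctx.subst]) trivial trivial rfl rfl
      (by simp [Ctx.subst]) (by simp [Ctx.subst, NDiword.word] <;> omega) trivial
  · exact incl_mem hS hf hg hfb hgb trivial (Ctx.center e m)
      (by simp [Ctx.subst]) trivial (by simp [Ctx.subst]) trivial

theorem key_CC (hS : IsGSB S) (hf : f ∈ S) (hg : g ∈ S) (hfb : IsMaxTerm f fb)
    (hgb : IsMaxTerm g gb) (a a' b b' : List X)
    (h : (Ctx.center a b).subst fb = (Ctx.center a' b').subst gb) :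
    ev (Ctx.center a b) f - ev (Ctx.center a' b') g ∈ NB S ((Ctx.center a b).subst fb) := by
  have h' := h
  simp only [Ctx.subst, NDiword.mk.injEq] at h'
  rcases List.append_eq_append_iff.1 h'.1 with ⟨m, rfl, -⟩ | ⟨m, rfl, -⟩
  · exact key_CC' hS hf hg hfb hgb _ _ _ _ h
  · exact swap_mem h (key_CC' hS hg hf hgb hfb _ _ _ _ h.symm)

theorem key_LR (hf : f ∈ S) (hg : g ∈ S) (hfb : IsMaxTerm f fb)
    (hgb : IsMaxTerm g gb) (hf1 : f fb = 1) (hg1 : g gb = 1) (a b : List X) (w w' : NDiword X)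
    (hcf : LeftNormed f) (hcg : RightNormed g)
    (h : (Ctx.left a w).subst fb = (Ctx.right w' b).subst gb) :
    ev (Ctx.left a w) f - ev (Ctx.right w' b) g ∈ NB S ((Ctx.left a w).subst fb) := by
  obtain ⟨l, c, r⟩ := w
  obtain ⟨l', c', r'⟩ := w'
  simp only [Ctx.subst, NDiword.mk.injEq] at h
  obtain ⟨rfl, rfl, rfl⟩ := h
  exact disj_mem S hf hg hfb hgb hf1 hg1 (fun v => Ctx.left a ⟨l, c, r' ++ v.word ++ b⟩)
    (fun u => Ctx.right ⟨a ++ u.word ++ l, c, r'⟩ b) (fun _ => hcf) (fun _ => hcg)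
    (by simp [Ctx.subst])

theorem key_CR (hS : IsGSB S) (hf : f ∈ S) (hg : g ∈ S) (hfb : IsMaxTerm f fb)
    (hgb : IsMaxTerm g gb) (hf1 : f fb = 1) (hg1 : g gb = 1) (a b d : List X) (w : NDiword X)
    (hcg : RightNormed g)
    (h : (Ctx.center a b).subst fb = (Ctx.right w d).subst gb) :
    ev (Ctx.center a b) f - ev (Ctx.right w d) g ∈ NB S ((Ctx.center a b).subst fb) := by
  obtain ⟨l, c, r⟩ := w
  obtain ⟨fl, fc, fr⟩ := fb
  simp only [Ctx.subst, NDiword.mk.injEq, List.append_assoc] at h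
  obtain ⟨rfl, rfl, h⟩ := h
  rcases List.append_eq_append_iff.1 h with ⟨m, rfl, rfl⟩ | ⟨e, rfl, h2⟩
  · have := disj_mem S hf hg hfb hgb hf1 hg1 (fun v => Ctx.center a (m ++ (v.word ++ d)))
      (fun u => Ctx.right ⟨a ++ u.left, u.center, u.right ++ m⟩ d) (fun _ => trivial)
      (fun _ => hcg) (by simp [Ctx.subst])
    simpa using this
  · rcases List.append_eq_append_iff.1 h2 with ⟨m, rfl, rfl⟩ | ⟨m, hG, rfl⟩
    · exact incl_mem hS hf hg hfb hgb trivial (Ctx.right ⟨fl, fc, r⟩ m)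
        (by simp [Ctx.subst]) hcg (by simp [Ctx.subst]) trivial
    · by_cases he : e = []
      · subst he
        have hm : m = gb.word := by simpa using hG.symm
        subst hm
        have := disj_mem S hf hg hfb hgb hf1 hg1 (fun v => Ctx.center a (v.word ++ d))
          (fun u => Ctx.right ⟨a ++ u.left, u.center, u.right⟩ d) (fun _ => trivial)
          (fun _ => hcg) (by simp [Ctx.subst])
        simpa using this
      · have := List.length_pos_iff.2 he
        exact inter_mem hS hf hg hfb hgb (Ctx.center a d) (Ctx.center [] m)
          (Ctx.right ⟨fl, fc, r⟩ [])
          (by simp [Ctx.subst]) (by simp [Ctx.subst]) trivial hcg rfl rfl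
          (by simp [Ctx.subst, hG]) (by rw [hG]; simp [Ctx.subst, NDiword.word]; omega) trivial

theorem key_LC (hS : IsGSB S) (hf : f ∈ S) (hg : g ∈ S) (hfb : IsMaxTerm f fb)
    (hgb : IsMaxTerm g gb) (hf1 : f fb = 1) (hg1 : g gb = 1) (a a' b : List X) (w : NDiword X)
    (hcf : LeftNormed f)
    (h : (Ctx.left a w).subst fb = (Ctx.center a' b).subst gb) :
    ev (Ctx.left a w) f - ev (Ctx.center a' b) g ∈ NB S ((Ctx.left a w).subst fb) := by
  have h0 := h
  obtain ⟨l, c, r⟩ := w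
  obtain ⟨gl, gc, gr⟩ := gb
  simp only [Ctx.subst, NDiword.mk.injEq] at h
  obtain ⟨h, rfl, rfl⟩ := h
  have disj : ∀ m, a' = a ++ fb.word ++ m → l = m ++ gl →
      ev (Ctx.left a ⟨l, c, gr ++ b⟩) f - ev (Ctx.center a' b) g
        ∈ NB S ((Ctx.left a ⟨l, c, gr ++ b⟩).subst fb) := by
    rintro m rfl rfl
    exact disj_mem S hf hg hfb hgb hf1 hg1
      (fun v => Ctx.left a ⟨m ++ v.left, v.center, v.right ++ b⟩)
      (fun u => Ctx.center (a ++ u.word ++ m) b) (fun _ => hcf)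
      (fun _ => trivial) (by simp [Ctx.subst])
  rcases List.append_eq_append_iff.1 h with ⟨m, h1, h2⟩ | ⟨e, h2, rfl⟩
  · exact disj m h1 h2
  · by_cases he : e = []
    · subst he
      exact disj [] (by simpa using h2.symm) (by simp)
    have := List.length_pos_iff.2 he
    rcases List.append_eq_append_iff.1 h2 with ⟨m, rfl, hF⟩ | ⟨m, rfl, rfl⟩
    · exact inter_mem hS hf hg hfb hgb (Ctx.center a b) (Ctx.left [] ⟨l, c, gr⟩)
          (Ctx.center m [])
          (by simp [Ctx.subst]) (by simp [Ctx.subst]) hcf trivial rfl rfl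
          (by simp [Ctx.subst, hF]) (by simp [Ctx.subst, NDiword.word]; omega) trivial
    · exact swap_mem h0 (incl_mem hS hg hf hgb hfb trivial (Ctx.left m ⟨l, c, gr⟩)
        (by simp [Ctx.subst]) hcf (by simp [Ctx.subst]) trivial)

theorem key_RR' (hS : IsGSB S) (hf : f ∈ S) (hg : g ∈ S) (hfb : IsMaxTerm f fb)
    (hgb : IsMaxTerm g gb) (hf1 : f fb = 1) (hg1 : g gb = 1) (b b' l r e : List X) (c : X)
    (hcf : RightNormed f) (hcg : RightNormed g)
    (h : fb.word ++ b = e ++ (gb.word ++ b')) :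
    ev (Ctx.right ⟨l, c, r⟩ b) f - ev (Ctx.right ⟨l, c, r ++ e⟩ b') g
      ∈ NB S ((Ctx.right ⟨l, c, r⟩ b).subst fb) := by
  have hfl : fb.left = [] := hcf _ hfb.1
  have hgl : gb.left = [] := hcg _ hgb.1
  have disj : ∀ m, e = fb.word ++ m → b = m ++ (gb.word ++ b') → 
      ev (Ctx.right ⟨l, c, r⟩ b) f - ev (Ctx.right ⟨l, c, r ++ e⟩ b') g
      ∈ NB S ((Ctx.right ⟨l, c, r⟩ b).subst fb) := by
    rintro m rfl rfl
    exact disj_mem S hf hg hfb hgb hf1 hg1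
      (fun v => Ctx.right ⟨l, c, r⟩ (m ++ (v.word ++ b')))
      (fun u => Ctx.right ⟨l, c, r ++ (u.word ++ m)⟩ b') (fun _ => hcf)
      (fun _ => hcg) (by simp [Ctx.subst])
  obtain ⟨fl, fc, fr⟩ := fb
  obtain ⟨gl, gc, gr⟩ := gb
  simp only at hfl hgl
  subst hfl hgl
  rcases List.append_eq_append_iff.1 h with ⟨m, h1, h2⟩ | ⟨e', hF, h⟩
  · exact disj m h1 h2
  by_cases he : e' = []
  · subst he
    exact disj [] (by simpa using hF.symm) (by simpa using h.symm)
  have hpos := List.length_pos_iff.2 he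
  rcases List.append_eq_append_iff.1 h with ⟨m, rfl, rfl⟩ | ⟨m, hG, rfl⟩
  · -- g inside f
    cases e with
    | nil =>
      simp [NDiword.word] at hF
      obtain ⟨rfl, rfl⟩ := hF
      exact incl_mem hS hf hg hfb hgb hcf (Ctx.center [] m) (by simp [Ctx.subst, NDiword.word])
        trivial (by simp [Ctx.subst]) ⟨hcg, by simp [Ctx.subst]⟩
    | cons x e =>
      simp [NDiword.word] at hF
      obtain ⟨rfl, rfl⟩ := hF
      exact incl_mem hS hf hg hfb hgb hcf (Ctx.right ⟨[], fc, e⟩ m)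
        (by simp [Ctx.subst, NDiword.word])
        hcg (by simp [Ctx.subst, NDiword.word]) ⟨hcg, by simp [Ctx.subst]⟩
  · cases e with
    | nil =>
      simp [NDiword.word] at hF hG
      subst hF
      simp at hG
      obtain ⟨rfl, rfl⟩ := hG
      exact inter_mem hS hf hg hfb hgb (Ctx.right ⟨l, c, r⟩ b') (Ctx.center [] m)
        (Ctx.center [] []) (by simp [Ctx.subst, NDiword.word]) (by simp [Ctx.subst, NDiword.word])
        trivial trivial rfl rfl (by simp [Ctx.subst]) (by simp [Ctx.subst, NDiword.word] <;> omega)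
        ⟨hcf, hcg, by simp [Ctx.subst]⟩
    | cons x e =>
      simp [NDiword.word] at hF hG
      obtain ⟨rfl, rfl⟩ := hF
      have hG' := congrArg List.length hG
      simp at hG'
      exact inter_mem hS hf hg hfb hgb (Ctx.right ⟨l, c, r⟩ b') (Ctx.center [] m)
        (Ctx.right ⟨[], fc, e⟩ []) (by simp [Ctx.subst, NDiword.word])
        (by simp [Ctx.subst, NDiword.word])
        trivial hcg rfl rfl (by simp [Ctx.subst, NDiword.word, hG])
        (by simp [Ctx.subst, NDiword.word]; omega)
        ⟨hcf, hcg, by simp [Ctx.subst]⟩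

theorem key_RR (hS : IsGSB S) (hf : f ∈ S) (hg : g ∈ S) (hfb : IsMaxTerm f fb)
    (hgb : IsMaxTerm g gb) (hf1 : f fb = 1) (hg1 : g gb = 1) (b b' : List X) (w w' : NDiword X)
    (hcf : RightNormed f) (hcg : RightNormed g)
    (h : (Ctx.right w b).subst fb = (Ctx.right w' b').subst gb) :
    ev (Ctx.right w b) f - ev (Ctx.right w' b') g ∈ NB S ((Ctx.right w b).subst fb) := by
  have h0 := h
  obtain ⟨l, c, r⟩ := w
  obtain ⟨l', c', r'⟩ := w'
  simp only [Ctx.subst, NDiword.mk.injEq, List.append_assoc] at h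
  obtain ⟨rfl, rfl, h⟩ := h
  rcases List.append_eq_append_iff.1 h with ⟨m, rfl, h2⟩ | ⟨m, rfl, h2⟩
  · exact key_RR' hS hf hg hfb hgb hf1 hg1 _ _ _ _ _ _ hcf hcg h2
  · exact swap_mem h0 (key_RR' hS hg hf hgb hfb hg1 hf1 _ _ _ _ _ _ hcg hcf h2)

theorem key_LL' (hS : IsGSB S) (hf : f ∈ S) (hg : g ∈ S) (hfb : IsMaxTerm f fb)
    (hgb : IsMaxTerm g gb) (hf1 : f fb = 1) (hg1 : g gb = 1) (a a' l r e : List X) (c : X)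
    (hcf : LeftNormed f) (hcg : LeftNormed g)
    (h : a ++ fb.word ++ e = a' ++ gb.word) :
    ev (Ctx.left a ⟨e ++ l, c, r⟩) f - ev (Ctx.left a' ⟨l, c, r⟩) g
      ∈ NB S ((Ctx.left a ⟨e ++ l, c, r⟩).subst fb) := by
  have h0 : (Ctx.left a ⟨e ++ l, c, r⟩).subst fb = (Ctx.left a' ⟨l, c, r⟩).subst gb := by
    simp only [Ctx.subst, ← h]
    simp
  have hfl : fb.right = [] := hcf _ hfb.1
  have hgl : gb.right = [] := hcg _ hgb.1
  have disj : ∀ m, e = m ++ gb.word → a' = a ++ fb.word ++ m → 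
      ev (Ctx.left a ⟨e ++ l, c, r⟩) f - ev (Ctx.left a' ⟨l, c, r⟩) g
      ∈ NB S ((Ctx.left a ⟨e ++ l, c, r⟩).subst fb) := by
    rintro m rfl rfl
    exact disj_mem S hf hg hfb hgb hf1 hg1
      (fun v => Ctx.left a ⟨m ++ v.word ++ l, c, r⟩)
      (fun u => Ctx.left (a ++ u.word ++ m) ⟨l, c, r⟩) (fun _ => hcf)
      (fun _ => hcg) (by simp [Ctx.subst])
  obtain ⟨fl, fc, fr⟩ := fb
  obtain ⟨gl, gc, gr⟩ := gb
  simp only at hfl hgl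
  subst hfl hgl
  rcases List.append_eq_append_iff.1 h with ⟨m, h1, h2⟩ | ⟨e', h, hG⟩
  · exact disj m h2 h1
  by_cases he : e' = []
  · subst he
    exact disj [] (by simpa using hG.symm) (by simpa using h.symm)
  have hpos := List.length_pos_iff.2 he
  rcases List.append_eq_append_iff.1 h with ⟨m, rfl, hF⟩ | ⟨m, rfl, rfl⟩
  · rcases List.eq_nil_or_concat' e with rfl | ⟨e, x, rfl⟩
    · simp only [List.append_nil] at hG
      subst hG
      have hF' := congrArg List.length hF
      simp [NDiword.word] at hF'
      have hF2 : fl = m ++ gl ∧ fc = gc := by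
        simp only [NDiword.word, ← List.append_assoc] at hF
        simpa using List.append_inj' hF rfl
      obtain ⟨rfl, rfl⟩ := hF2
      exact inter_mem hS hf hg hfb hgb (Ctx.left a ⟨l, c, r⟩) (Ctx.center [] [])
        (Ctx.center m []) (by simp [Ctx.subst, NDiword.word]) (by simp [Ctx.subst, NDiword.word])
        trivial trivial rfl rfl (by simp [Ctx.subst]) (by simp [Ctx.subst, NDiword.word])
        ⟨hcf, hcg, by simp [Ctx.subst]⟩
    · have hG2 : gl = e' ++ e ∧ gc = x := by
        simp only [NDiword.word, ← List.append_assoc] at hG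
        simpa using List.append_inj' hG rfl
      obtain ⟨rfl, rfl⟩ := hG2
      exact inter_mem hS hf hg hfb hgb (Ctx.left a ⟨l, c, r⟩) (Ctx.left [] ⟨e, gc, []⟩)
        (Ctx.center m []) (by simp [Ctx.subst, NDiword.word]) (by simp [Ctx.subst, NDiword.word])
        hcf trivial rfl rfl (by simp [Ctx.subst, hF]) (by simp [Ctx.subst, NDiword.word]; omega)
        ⟨hcf, hcg, by simp [Ctx.subst]⟩
  · refine swap_mem h0 ?_
    rcases List.eq_nil_or_concat' e with rfl | ⟨e, x, rfl⟩
    · have hG2 : gl = m ++ fl ∧ gc = fc := by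
        simp only [NDiword.word, ← List.append_assoc, List.append_nil] at hG
        simpa using List.append_inj' hG rfl
      obtain ⟨rfl, rfl⟩ := hG2
      exact incl_mem hS hg hf hgb hfb hcg (Ctx.center m [])
        (by simp [Ctx.subst, NDiword.word])
        trivial (by simp [Ctx.subst]) ⟨hcf, by simp [Ctx.subst]⟩
    · have hG2 : gl = m ++ (fl ++ [fc]) ++ e ∧ gc = x := by
        simp only [NDiword.word, ← List.append_assoc] at hG
        simpa using List.append_inj' hG rfl
      obtain ⟨rfl, rfl⟩ := hG2
      exact incl_mem hS hg hf hgb hfb hcg (Ctx.left m ⟨e, gc, []⟩)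
        (by simp [Ctx.subst, NDiword.word])
        hcf (by simp [Ctx.subst, NDiword.word]) ⟨hcf, by simp [Ctx.subst]⟩

theorem key_LL (hS : IsGSB S) (hf : f ∈ S) (hg : g ∈ S) (hfb : IsMaxTerm f fb)
    (hgb : IsMaxTerm g gb) (hf1 : f fb = 1) (hg1 : g gb = 1) (a a' : List X) (w w' : NDiword X)
    (hcf : LeftNormed f) (hcg : LeftNormed g)
    (h : (Ctx.left a w).subst fb = (Ctx.left a' w').subst gb) :
    ev (Ctx.left a w) f - ev (Ctx.left a' w') g ∈ NB S ((Ctx.left a w).subst fb) := by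
  have h0 := h
  obtain ⟨l, c, r⟩ := w
  obtain ⟨l', c', r'⟩ := w'
  simp only [Ctx.subst, NDiword.mk.injEq] at h
  obtain ⟨h, rfl, rfl⟩ := h
  rcases List.append_eq_append_iff.1 h with ⟨m, h2, rfl⟩ | ⟨m, h2, rfl⟩
  · exact key_LL' hS hf hg hfb hgb hf1 hg1 _ _ _ _ _ _ hcf hcg h2.symm
  · exact swap_mem h0 (key_LL' hS hg hf hgb hfb hg1 hf1 _ _ _ _ _ _ hcg hcf h2.symm)

theorem key (hS : IsGSB S) (hf : f ∈ S) (hg : g ∈ S) (hfb : IsMaxTerm f fb)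
    (hgb : IsMaxTerm g gb) (hf1 : f fb = 1) (hg1 : g gb = 1) (cf cg : Ctx X)
    (hcf : IsNormalFor f cf) (hcg : IsNormalFor g cg)
    (h : cf.subst fb = cg.subst gb) :
    ev cf f - ev cg g ∈ NB S (cf.subst fb) := by
  cases cf with
  | center a b =>
    cases cg with
    | center a' b' => exact key_CC hS hf hg hfb hgb _ _ _ _ h
    | left a' w' => exact swap_mem h (key_LC hS hg hf hgb hfb hg1 hf1 _ _ _ _ hcg h.symm)
    | right w' b' => exact key_CR hS hf hg hfb hgb hf1 hg1 _ _ _ _ hcg h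
  | left a w =>
    cases cg with
    | center a' b' => exact key_LC hS hf hg hfb hgb hf1 hg1 _ _ _ _ hcf h
    | left a' w' => exact key_LL hS hf hg hfb hgb hf1 hg1 _ _ _ _ hcf hcg h
    | right w' b' => exact key_LR hf hg hfb hgb hf1 hg1 _ _ _ _ hcf hcg h
  | right w b =>
    cases cg with
    | center a' b' => exact swap_mem h (key_CR hS hg hf hgb hfb hg1 hf1 _ _ _ _ hcf h.symm)
    | left a' w' => exact swap_mem h (key_LR hg hf hgb hfb hg1 hf1 _ _ _ _ hcg hcf h.symm)
    | right w' b' => exact key_RR hS hf hg hfb hgb hf1 hg1 _ _ _ _ hcf hcg h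

end Cases

/-- chosen generator with leading word w -/
theorem main_aux [WellFoundedLT X] (S : Set (FreeDialg k X)) (hS : IsGSB S)
    (f : FreeDialg k X) (hf : f ∈ NS S) (fb : NDiword X) (hfb : IsMaxTerm f fb) :
    ∃ s ∈ S, ∃ (c : Ctx X) (sb : NDiword X),
      IsNormalFor s c ∧ IsMaxTerm s sb ∧ fb = c.subst sb := by
  classical
  let R : NDiword X → Prop := fun w => ∃ p : FreeDialg k X × Ctx X × NDiword X,
    p.1 ∈ S ∧ IsNormalFor p.1 p.2.1 ∧ IsMaxTerm p.1 p.2.2 ∧ w = p.2.1.subst p.2.2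
  let G : NDiword X → FreeDialg k X := fun w =>
    if h : R w then ev h.choose.2.1 h.choose.1 else 0
  have hG : ∀ w, R w → G w w = 1 ∧ ∀ v ∈ (G w).support, v ≠ w → v.dlt w := by
    intro w h
    have e : G w = ev h.choose.2.1 h.choose.1 := dif_pos h
    obtain ⟨h1, h2, h3, h4⟩ := h.choose_spec
    obtain ⟨u, hu, hu1⟩ := hS.1 _ h1
    obtain rfl := max_unique hu h3
    have := ev_lead _ _ h2 _ h3 hu1
    rw [← h4] at this
    rw [e]
    exact this
  have hspan : ∀ w, ∀ s ∈ S, ∀ c sb, IsNormalFor s c → IsMaxTerm s sb → w = c.subst sb →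
      ev c s ∈ Submodule.span k (G '' {w | R w}) := by
    intro w
    induction w using (dlt_wf (X := X)).induction with
    | _ w ih =>
      intro s hs c sb hc hsb hw
      have h : R w := ⟨(s, c, sb), hs, hc, hsb, hw⟩
      have e : G w = ev h.choose.2.1 h.choose.1 := dif_pos h
      obtain ⟨h1, h2, h3, h4⟩ := h.choose_spec
      obtain ⟨u, hu, hu1⟩ := hS.1 _ h1
      obtain rfl := max_unique hu h3
      obtain ⟨u', hu', hu1'⟩ := hS.1 _ hs
      obtain rfl := max_unique hu' hsb
      have hk := key hS hs h1 hsb h3 hu1' hu1 c _ hc h2 (hw.symm.trans h4)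
      rw [← e, ← hw] at hk
      have hle : NB S w ≤ Submodule.span k (G '' {w | R w}) := by
        refine Submodule.span_le.2 ?_
        rintro _ ⟨t, ht, d, hd, hlt, rfl⟩
        obtain ⟨tb, htb, -⟩ := hS.1 _ ht
        exact ih _ (hlt _ htb) t ht d tb hd htb rfl
      have := add_mem (hle hk) (Submodule.subset_span ⟨w, h, rfl⟩)
      simpa using this
  have hmem : f ∈ Submodule.span k (G '' {w | R w}) := by
    refine (Submodule.span_le.2 ?_ : NS S ≤ _) hf
    rintro _ ⟨t, ht, d, hd, rfl⟩
    obtain ⟨tb, htb, -⟩ := hS.1 _ ht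
    exact hspan _ t ht d tb hd htb rfl
  rw [Finsupp.mem_span_image_iff_linearCombination] at hmem
  obtain ⟨l, hl, rfl⟩ := hmem
  have hl' : ∀ v ∈ l.support, R v := fun v hv => hl hv
  have hne : l.support.Nonempty := by
    rw [Finset.nonempty_iff_ne_empty]
    intro h
    rw [Finsupp.support_eq_empty] at h
    subst h
    simpa using hfb.1
  obtain ⟨w, hw, hmax⟩ := Finset.exists_max_image l.support wt hne
  have hmax' : ∀ v ∈ l.support, v ≠ w → v.dlt w := fun v hv hne => by
    rw [dlt_iff]
    exact lt_of_le_of_ne (hmax v hv) fun h => hne (wt_inj h)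
  have hF : IsMaxTerm (Finsupp.linearCombination k G l) w := by
    constructor
    · rw [Finsupp.mem_support_iff, Finsupp.linearCombination_apply, Finsupp.sum,
        Finsupp.finsetSum_apply, Finset.sum_eq_single w]
      · simpa [(hG w (hl' w hw)).1] using hw
      · intro v hv hvw
        have : w ∉ (G v).support := fun hh =>
          dlt_asymm ((hG v (hl' v hv)).2 w hh (Ne.symm hvw)) (hmax' v hv hvw)
        rw [Finsupp.notMem_support_iff] at this
        simp [this]
      · intro h; exact absurd hw h
    · intro v hv hvw
      rw [Finsupp.linearCombination_apply, Finsupp.sum] at hv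
      obtain ⟨z, hz, hvz⟩ := Finset.mem_biUnion.1 (Finsupp.support_finsetSum hv)
      have hvz := Finsupp.support_smul hvz
      by_cases hzw : z = w
      · subst hzw
        exact (hG z (hl' z hz)).2 v hvz hvw
      · by_cases hvz' : v = z
        · subst hvz'; exact hmax' v hz hvw
        · have h1 := (hG z (hl' z hz)).2 v hvz hvz'
          have h2 := hmax' z hz hzw
          rw [dlt_iff] at h1 h2 ⊢
          exact h1.trans h2
  obtain rfl := max_unique hfb hF
  obtain ⟨⟨s, c, sb⟩, h1, h2, h3, h4⟩ := hl' _ hw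
  exact ⟨s, h1, c, sb, h2, h3, h4⟩

end Order

end Aux

/-- Composition–Diamond lemma, (i) ⇒ (ii): if `S` is a
Gröbner–Shirshov basis, then the leading term of every nonzero element of `Id(S)`
has the form `[a[s̄]b]` for some `s ∈ S` and normal `s`-diword `[asb]`. -/
theorem gsb_leading_term_of_ideal {k X : Type*} [Field k] [LinearOrder X]
    [WellFoundedLT X] (S : Set (FreeDialg k X)) (hgsb : IsGSB S)
    (f : FreeDialg k X) (hf : f ∈ dialgIdeal S) (hf0 : f ≠ 0)
    (fb : NDiword X) (hfb : IsMaxTerm f fb) :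
    ∃ s ∈ S, ∃ (c : Ctx X) (sb : NDiword X),
      IsNormalFor s c ∧ IsMaxTerm s sb ∧ fb = c.subst sb := by
  exact main_aux S hgsb f (ideal_le_NS S hgsb f hf) fb hfb
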